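/- Let R be a commutative ring and let 0 → L → E → F → 0 be an exact sequence of finite projective R-modules with L of rank 1 (a line bundle quotient situation: F = E/L). Then for every i > 0 there is a natural short exact sequence 0 → Λ^i F^∨ → Λ^i E^∨ → Λ^{i-1} F^∨ ⊗ L^∨ → 0. -/

import Mathlib

open TensorProduct

/-- The linear map `Λⁿ f : Λⁿ M → Λⁿ N` on exterior powers induced by a linear map
`f : M → N`, obtained by restricting the algebra map `Λ f : Λ M → Λ N`. -/
noncomputable def exteriorPowerMap
    {R : Type*} [CommRing R] {M N : Type*}
    [AddCommGroup M] [Module R M] [AddCommGroup N] [Module R N]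
    (n : ℕ) (f : M →ₗ[R] N) : ↥(⋀[R]^n M) →ₗ[R] ↥(⋀[R]^n N) :=
  (ExteriorAlgebra.map f).toLinearMap.restrict (p := ⋀[R]^n M) (q := ⋀[R]^n N)
    (by
      intro x hx
      rw [← ExteriorAlgebra.ιMulti_span_fixedDegree] at hx ⊢
      induction hx using Submodule.span_induction with
      | mem x h =>
        obtain ⟨m, rfl⟩ := h
        rw [AlgHom.toLinearMap_apply, ExteriorAlgebra.map_apply_ιMulti]
        exact Submodule.subset_span ⟨_, rfl⟩
      | zero => simp
      | add x y _ _ hx hy => rw [map_add]; exact add_mem hx hy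
      | smul c x _ hx => rw [map_smul]; exact Submodule.smul_mem _ c hx)

namespace TwoStep

variable {R : Type*} [CommRing R]

theorem exteriorPowerMap_eq {M N : Type*}
    [AddCommGroup M] [Module R M] [AddCommGroup N] [Module R N]
    (n : ℕ) (f : M →ₗ[R] N) : exteriorPowerMap n f = exteriorPower.map n f := by
  apply exteriorPower.linearMap_ext
  ext a
  simp [exteriorPowerMap, ExteriorAlgebra.map_apply_ιMulti]
  rfl

theorem dual_exchange {C : Type*} [AddCommGroup C] [Module R C] [Module.Invertible R C]
    (φ : Module.Dual R C) (x y : C) : φ x • y = φ y • x := by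
  have h := LinearEquiv.congr_fun (Module.Invertible.tensorProductComm_eq_refl (R := R) (M := C))
    (y ⊗ₜ[R] x)
  simp only [TensorProduct.comm_tmul, LinearEquiv.refl_apply] at h
  have := congrArg (TensorProduct.lift ((LinearMap.lsmul R C).comp φ)) h
  simpa using this

theorem ι_mul_ι_eq_zero {B C : Type*} [AddCommGroup C] [Module R C] [Module.Invertible R C]
    [AddCommGroup B] [Module R B] (s : C →ₗ[R] B) (c d : C) :
    ExteriorAlgebra.ι R (s c) * ExteriorAlgebra.ι R (s d) = 0 := by
  set w := ExteriorAlgebra.ι R (s c) * ExteriorAlgebra.ι R (s d) with hw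
  let S : Set R := {t | ∃ (φ : Module.Dual R C) (x : C), φ x = t}
  have hS : Ideal.span S = ⊤ := by
    rw [Ideal.eq_top_iff_one]
    obtain ⟨t, ht⟩ := (Module.Invertible.bijective (R := R) (M := C)).2 1
    rw [← ht]
    clear ht
    induction t with
    | zero => simp
    | tmul φ x => exact Ideal.subset_span ⟨φ, x, by simp⟩
    | add x y hx hy => rw [map_add]; exact add_mem hx hy
  have h2 := Ideal.span_pow_eq_top S hS 2
  have hle : Ideal.span ((fun x => x ^ 2) '' S) ≤ LinearMap.ker (LinearMap.toSpanSingleton R _ w) := by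
    rw [Ideal.span_le]
    rintro _ ⟨_, ⟨φ, x, rfl⟩, rfl⟩
    simp only [SetLike.mem_coe, LinearMap.mem_ker, LinearMap.toSpanSingleton_apply]
    have : (φ x ^ 2) • w = ExteriorAlgebra.ι R (s (φ x • c)) * ExteriorAlgebra.ι R (s (φ x • d)) := by
      simp [hw, sq, smul_smul]
    rw [this, dual_exchange φ x c, dual_exchange φ x d]
    simp
  rw [h2] at hle
  have := hle (Submodule.mem_top (x := (1 : R)))
  simpa using this

theorem pow_le {T : Type*} [Ring T] [Algebra R T] (U V : Submodule R T)
    (hV : V * V = ⊥) (hUV : U * V ≤ V * U) (n : ℕ) :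
    (U ⊔ V) ^ (n + 1) ≤ U ^ (n + 1) ⊔ V * U ^ n := by
  induction n with
  | zero => simp
  | succ n ih =>
    rw [pow_succ']
    refine (mul_le_mul' le_rfl ih).trans ?_
    rw [Submodule.sup_mul, Submodule.mul_sup, Submodule.mul_sup]
    refine sup_le (sup_le ?_ ?_) (sup_le ?_ ?_)
    · rw [← pow_succ']; exact le_sup_left
    · rw [← mul_assoc]
      refine (mul_le_mul' hUV le_rfl).trans ?_
      rw [mul_assoc, ← pow_succ']; exact le_sup_right
    · exact le_sup_right
    · rw [← mul_assoc, hV]; simp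

variable {A B C : Type*} [AddCommGroup A] [AddCommGroup B] [AddCommGroup C]
  [Module R A] [Module R B] [Module R C]

/-- The bilinear-alternating form underlying `psi`. -/
noncomputable def psiForm {P : Type*} [AddCommGroup P] [Module R P] (n : ℕ)
    (μ : A [⋀^Fin n]→ₗ[R] P) (r : B →ₗ[R] A) (q : B →ₗ[R] C) :
    B →ₗ[R] B [⋀^Fin n]→ₗ[R] (P ⊗[R] C) where
  toFun b := (((TensorProduct.mk R P C).flip (q b)).compAlternatingMap μ).compLinearMap r
  map_add' x y := by ext; simp [TensorProduct.tmul_add]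
  map_smul' x y := by ext; simp

/-- The quotient map on the exterior power. -/
noncomputable def psiGen {P : Type*} [AddCommGroup P] [Module R P] (n : ℕ)
    (μ : A [⋀^Fin n]→ₗ[R] P) (r : B →ₗ[R] A) (q : B →ₗ[R] C) :
    ⋀[R]^(n + 1) B →ₗ[R] P ⊗[R] C :=
  exteriorPower.alternatingMapLinearEquiv (AlternatingMap.alternatizeUncurryFin (psiForm n μ r q))

theorem psiGen_ιMulti {P : Type*} [AddCommGroup P] [Module R P] (n : ℕ)
    (μ : A [⋀^Fin n]→ₗ[R] P) (r : B →ₗ[R] A) (q : B →ₗ[R] C) (b : Fin (n + 1) → B) :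
    psiGen n μ r q (exteriorPower.ιMulti R (n + 1) b) =
      ∑ k : Fin (n + 1), (-1) ^ (k : ℕ) •
        (μ (fun l => r (k.removeNth b l)) ⊗ₜ[R] q (b k)) := by
  simp only [psiGen, exteriorPower.alternatingMapLinearEquiv_apply_ιMulti,
    AlternatingMap.alternatizeUncurryFin_apply]
  rfl

theorem psiGen_map {P : Type*} [AddCommGroup P] [Module R P] (n : ℕ)
    (μ : A [⋀^Fin n]→ₗ[R] P) (j : A →ₗ[R] B) (r : B →ₗ[R] A) (q : B →ₗ[R] C)
    (hqj : ∀ a, q (j a) = 0) :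
    psiGen n μ r q ∘ₗ exteriorPower.map (n + 1) j = 0 := by
  apply exteriorPower.linearMap_ext
  ext a
  simp [psiGen_ιMulti, hqj]

theorem psiGen_cons {P : Type*} [AddCommGroup P] [Module R P] (n : ℕ)
    (μ : A [⋀^Fin n]→ₗ[R] P) (j : A →ₗ[R] B) (s : C →ₗ[R] B) (r : B →ₗ[R] A) (q : B →ₗ[R] C)
    (hrj : ∀ a, r (j a) = a) (hqs : ∀ c, q (s c) = c) (hqj : ∀ a, q (j a) = 0)
    (a : Fin n → A) (c : C) :
    psiGen n μ r q (exteriorPower.ιMulti R (n + 1) (Matrix.vecCons (s c) (j ∘ a))) =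
      μ a ⊗ₜ[R] c := by
  rw [psiGen_ιMulti, Fin.sum_univ_succ]
  simp [hqs, hqj, hrj, Fin.removeNth]

theorem tensor_ext {N : Type*} [AddCommGroup N] [Module R N] (n : ℕ)
    (f g : (⋀[R]^n A) ⊗[R] C →ₗ[R] N)
    (h : ∀ a c, f (exteriorPower.ιMulti R n a ⊗ₜ[R] c) = g (exteriorPower.ιMulti R n a ⊗ₜ[R] c)) :
    f = g := by
  apply TensorProduct.ext'
  intro x c
  have : f ∘ₗ (TensorProduct.mk R _ C).flip c = g ∘ₗ (TensorProduct.mk R _ C).flip c := by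
    apply exteriorPower.linearMap_ext
    ext a
    exact h a c
  exact LinearMap.congr_fun this x

/-- The quotient map on the exterior power. -/
noncomputable def psi (n : ℕ) (r : B →ₗ[R] A) (q : B →ₗ[R] C) :
    ⋀[R]^(n + 1) B →ₗ[R] (⋀[R]^n A) ⊗[R] C :=
  psiGen n (exteriorPower.ιMulti R n) r q

/-- The section of `psi`. -/
noncomputable def sigma (n : ℕ) (j : A →ₗ[R] B) (s : C →ₗ[R] B) :
    (⋀[R]^n A) ⊗[R] C →ₗ[R] ⋀[R]^(n + 1) B :=
  TensorProduct.lift (LinearMap.flip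
    { toFun := fun c => exteriorPower.alternatingMapLinearEquiv
        (((exteriorPower.ιMulti R (n + 1)).curryLeft (s c)).compLinearMap j)
      map_add' := fun x y => by
        rw [← map_add]; congr 1; ext; simp
      map_smul' := fun x y => by
        rw [RingHom.id_apply, ← map_smul]; congr 1; ext; simp })

theorem sigma_tmul (n : ℕ) (j : A →ₗ[R] B) (s : C →ₗ[R] B) (a : Fin n → A) (c : C) :
    sigma n j s (exteriorPower.ιMulti R n a ⊗ₜ[R] c) =
      exteriorPower.ιMulti R (n + 1) (Matrix.vecCons (s c) (j ∘ a)) := by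
  simp [sigma]
  rfl

theorem psi_sigma (n : ℕ) (j : A →ₗ[R] B) (s : C →ₗ[R] B) (r : B →ₗ[R] A) (q : B →ₗ[R] C)
    (hrj : ∀ a, r (j a) = a) (hqs : ∀ c, q (s c) = c) (hqj : ∀ a, q (j a) = 0) :
    psi n r q ∘ₗ sigma n j s = LinearMap.id := by
  refine tensor_ext (N := (⋀[R]^n A) ⊗[R] C) n _ _ fun a c => ?_
  rw [LinearMap.comp_apply, sigma_tmul]
  exact psiGen_cons n _ j s r q hrj hqs hqj a c

theorem psi_map (n : ℕ) (j : A →ₗ[R] B) (r : B →ₗ[R] A) (q : B →ₗ[R] C)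
    (hqj : ∀ a, q (j a) = 0) :
    psi n r q ∘ₗ exteriorPower.map (n + 1) j = 0 :=
  psiGen_map n _ j r q hqj

theorem span_aux [Module.Invertible R C] (n : ℕ) (j : A →ₗ[R] B) (s : C →ₗ[R] B)
    (htop : ∀ b, ∃ a c, b = j a + s c) (x : ⋀[R]^(n + 1) B) :
    ∃ y z, x = exteriorPower.map (n + 1) j y + sigma n j s z := by
  let U : Submodule R (ExteriorAlgebra R B) :=
    (LinearMap.range (ExteriorAlgebra.ι R (M := A))).map (ExteriorAlgebra.map j).toLinearMap
  let V : Submodule R (ExteriorAlgebra R B) := LinearMap.range (ExteriorAlgebra.ι R ∘ₗ s)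
  have hV : V * V = ⊥ := by
    rw [eq_bot_iff, Submodule.mul_le]
    rintro _ ⟨c, rfl⟩ _ ⟨d, rfl⟩
    exact ι_mul_ι_eq_zero s c d
  have hUV : U * V ≤ V * U := by
    rw [Submodule.mul_le]
    rintro _ ⟨_, ⟨a, rfl⟩, rfl⟩ _ ⟨c, rfl⟩
    have h : ExteriorAlgebra.ι R (j a) * ExteriorAlgebra.ι R (s c) =
        - (ExteriorAlgebra.ι R (s c) * ExteriorAlgebra.ι R (j a)) :=
      eq_neg_of_add_eq_zero_left (ExteriorAlgebra.ι_add_mul_swap _ _)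
    simp only [AlgHom.toLinearMap_apply, ExteriorAlgebra.map_apply_ι, LinearMap.comp_apply, h]
    refine neg_mem (Submodule.mul_mem_mul ⟨c, rfl⟩ ⟨_, ⟨a, rfl⟩, ?_⟩)
    simp
  have hUn : ∀ m, U ^ m = (⋀[R]^m A).map (ExteriorAlgebra.map j).toLinearMap := fun m =>
    (Submodule.map_pow _ (ExteriorAlgebra.map j) m).symm
  have hle : LinearMap.range (ExteriorAlgebra.ι R (M := B)) ≤ U ⊔ V := by
    rintro _ ⟨b, rfl⟩
    obtain ⟨a, c, rfl⟩ := htop b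
    rw [map_add]
    exact Submodule.add_mem_sup ⟨_, ⟨a, rfl⟩, by simp⟩ ⟨c, rfl⟩
  have hx := pow_le U V hV hUV n (pow_le_pow_left' hle (n + 1) x.2)
  have hVU : V * U ^ n ≤ (LinearMap.range (sigma n j s)).map (⋀[R]^(n + 1) B).subtype := by
    rw [Submodule.mul_le, hUn]
    rintro _ ⟨c, rfl⟩ _ ⟨y, hy, rfl⟩
    rw [SetLike.mem_coe, ← ExteriorAlgebra.ιMulti_span_fixedDegree] at hy
    induction hy using Submodule.span_induction with
    | mem y h =>
      obtain ⟨a, rfl⟩ := h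
      refine ⟨_, ⟨exteriorPower.ιMulti R n a ⊗ₜ[R] c, rfl⟩, ?_⟩
      rw [sigma_tmul, AlgHom.toLinearMap_apply, ExteriorAlgebra.map_apply_ιMulti]
      simp [ExteriorAlgebra.ιMulti_succ_apply]
    | zero => simp
    | add x y _ _ hx hy => rw [map_add, mul_add]; exact add_mem hx hy
    | smul c x _ hx => rw [map_smul, mul_smul_comm]; exact Submodule.smul_mem _ c hx
  obtain ⟨u, hu, v, hv, huv⟩ := Submodule.mem_sup.1 hx
  rw [hUn] at hu
  obtain ⟨y, hy, rfl⟩ := hu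
  obtain ⟨_, ⟨z, rfl⟩, rfl⟩ := hVU hv
  refine ⟨⟨y, hy⟩, z, Subtype.ext ?_⟩
  rw [← exteriorPowerMap_eq, ← huv]
  rfl

theorem main [Module.Invertible R C] (n : ℕ) (j : A →ₗ[R] B) (s : C →ₗ[R] B)
    (r : B →ₗ[R] A) (q : B →ₗ[R] C)
    (hrj : ∀ a, r (j a) = a) (hqs : ∀ c, q (s c) = c) (hqj : ∀ a, q (j a) = 0)
    (htop : ∀ b, ∃ a c, b = j a + s c) :
    Function.Injective (exteriorPowerMap (n + 1) j) ∧
      Function.Exact (exteriorPowerMap (n + 1) j) (psi n r q) ∧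
      Function.Surjective (psi n r q) := by
  have h1 := psi_sigma n j s r q hrj hqs hqj
  have h2 := psi_map n j r q hqj
  rw [exteriorPowerMap_eq]
  refine ⟨exteriorPower.map_injective r (LinearMap.ext hrj), fun x => ⟨fun hx => ?_, ?_⟩,
    fun z => ⟨sigma n j s z, LinearMap.congr_fun h1 z⟩⟩
  · obtain ⟨y, z, rfl⟩ := span_aux n j s htop x
    have h3 := LinearMap.congr_fun h1 z
    have h4 := LinearMap.congr_fun h2 y
    simp only [LinearMap.comp_apply, LinearMap.id_apply, LinearMap.zero_apply] at h3 h4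
    rw [map_add, h3, h4, zero_add] at hx
    exact ⟨y, by simp [hx]⟩
  · rintro ⟨y, rfl⟩
    exact LinearMap.congr_fun h2 y

end TwoStep

set_option synthInstance.maxHeartbeats 1000000 in
/-- **The two-step filtration of exterior powers for a rank-one subbundle.**
Let `0 → L → E → F → 0` be an exact sequence of finite projective `R`-modules with
`L` invertible (of rank 1), so `F = E/L`.  Dualizing gives
`0 → F^∨ → E^∨ → L^∨ → 0`.  Then for every `i > 0` there is a natural short exact
sequence `0 → Λⁱ F^∨ → Λⁱ E^∨ → Λ^{i-1} F^∨ ⊗ L^∨ → 0`, in which the first map is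
`Λⁱ` of the canonical inclusion `F^∨ → E^∨` (the dual of `p : E → F`). -/
theorem exteriorPower_dual_twoStep_filtration
    (R : Type*) [CommRing R]
    (L E F : Type*) [AddCommGroup L] [AddCommGroup E] [AddCommGroup F]
    [Module R L] [Module R E] [Module R F]
    [Module.Finite R L] [Module.Projective R L]
    [Module.Finite R E] [Module.Projective R E]
    [Module.Finite R F] [Module.Projective R F]
    (hL : Nonempty ((L ⊗[R] Module.Dual R L) ≃ₗ[R] R))
    (ι : L →ₗ[R] E) (p : E →ₗ[R] F)
    (hι : Function.Injective ι) (hp : Function.Surjective p)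
    (hexact : Function.Exact ι p)
    (i : ℕ) (hi : 0 < i) :
    ∃ ψ : ↥(⋀[R]^i (Module.Dual R E)) →ₗ[R]
        (↥(⋀[R]^(i - 1) (Module.Dual R F)) ⊗[R] Module.Dual R L),
      Function.Injective (exteriorPowerMap i p.dualMap) ∧
      Function.Exact (exteriorPowerMap i p.dualMap) ψ ∧
      Function.Surjective ψ := by

  obtain ⟨e⟩ := hL
  haveI : Module.Invertible R (Module.Dual R L) := Module.Invertible.right e
  obtain ⟨n, rfl⟩ : ∃ n, i = n + 1 := ⟨i - 1, by omega⟩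
  obtain ⟨t, ht⟩ := Module.projective_lifting_property p LinearMap.id hp
  have ht' : ∀ f, p (t f) = f := LinearMap.congr_fun ht
  have hpi : ∀ l, p (ι l) = 0 := hexact.apply_apply_eq_zero
  have hk : ∀ x, ∃ l, ι l = x - t (p x) := fun x => (hexact _).1 (by simp [ht'])
  choose g hg using hk
  let G : E →ₗ[R] L :=
    { toFun := g
      map_add' := fun x y => hι (by simp only [hg, map_add]; abel)
      map_smul' := fun c x => hι (by simp only [hg, map_smul, RingHom.id_apply, smul_sub]) }
  have hG : ∀ x, ι (G x) = x - t (p x) := hg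
  have hGi : ∀ l, G (ι l) = l := fun l => hι (by rw [hG, hpi, map_zero, sub_zero])
  refine ⟨TwoStep.psi n t.dualMap ι.dualMap,
    TwoStep.main n p.dualMap G.dualMap t.dualMap ι.dualMap ?_ ?_ ?_ ?_⟩
  · intro a; ext f; simp [ht']
  · intro c; ext l; simp [hGi]
  · intro a; ext l; simp [hpi]
  · intro b
    refine ⟨t.dualMap b, ι.dualMap b, ?_⟩
    ext x
    simp [hG]
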